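/- A perfect matching M in a many-to-many instance G is a popular perfect matching if and only if there exists a colorful version M* of M (an assignment of a color in {1,…,n₀} to each edge of M) that is a stable matching in the colorful multigraph instance G*. -/

import Mathlib

/-- Vote of a vertex comparing a neighbor of rank `x` with a neighbor of rank `y`
(lower rank = more preferred). -/
def vsgn (x y : ℕ) : ℤ := if x < y then 1 else if y < x then -1 else 0

/-- Vote in the cloned instance: clone preferences are lexicographic, first by the
rank of the underlying vertex, then by the clone index (lower index preferred). -/
def lsgn (r j r' j' : ℕ) : ℤ :=
  if r < r' ∨ (r = r' ∧ j < j') then 1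
  else if r' < r ∨ (r' = r ∧ j' < j) then -1 else 0

/-- The clones of the vertices of `A`: vertex `a` is replaced by `cap a` clones. -/
abbrev Clones {A : Type*} (cap : A → ℕ) : Type _ := (a : A) × Fin (cap a)

/-- `M(a)`, the set of jobs matched to agent `a`. -/
def jobsOf {A B : Type*} [DecidableEq A] [DecidableEq B]
    (M : Finset (A × B)) (a : A) : Finset B :=
  (M.filter (fun e => e.1 = a)).image Prod.snd

/-- `M(b)`, the set of agents matched to job `b`. -/
def agentsOf {A B : Type*} [DecidableEq A] [DecidableEq B]
    (M : Finset (A × B)) (b : B) : Finset A :=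
  (M.filter (fun e => e.2 = b)).image Prod.fst

/-- The set of possible values `∑_{u ∈ S} vote(u, σ u)` over bijections `σ : S ≃ T`;
the vote `vote_v(S,T)` of the paper is the least element of this set. -/
def voteSet {B : Type*} (r : B → ℕ) (S T : Finset B) : Set ℤ :=
  {z | ∃ σ : {x // x ∈ S} ≃ {x // x ∈ T},
    z = ∑ x : {x // x ∈ S}, vsgn (r x.1) (r ((σ x).1))}

/-- A perfect matching in the many-to-many instance: `M ⊆ E` and every vertex `v`
is matched to exactly `cap v` partners. -/
def IsPerfect {A B : Type*} [DecidableEq A] [DecidableEq B]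
    (E M : Finset (A × B)) (capA : A → ℕ) (capB : B → ℕ) : Prop :=
  M ⊆ E ∧ (∀ a, (M.filter (fun e => e.1 = a)).card = capA a) ∧
    ∀ b, (M.filter (fun e => e.2 = b)).card = capB b

/-- `M` is a popular perfect matching: `M` is perfect and `Δ(M,N) ≥ 0` for every
perfect matching `N`, where each vertex votes using the most adversarial bijection
between `M(v) \ N(v)` and `N(v) \ M(v)`.  Since the minima at distinct vertices are
independent, `Δ(M,N) ≥ 0` is equivalent to: every choice of one vote value per
vertex sums to a nonnegative number. -/
def PopularPerfect {A B : Type*} [Fintype A] [Fintype B] [DecidableEq A] [DecidableEq B]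
    (E : Finset (A × B)) (capA : A → ℕ) (capB : B → ℕ)
    (rA : A → B → ℕ) (rB : B → A → ℕ) (M : Finset (A × B)) : Prop :=
  IsPerfect E M capA capB ∧
    ∀ N : Finset (A × B), IsPerfect E N capA capB →
      ∀ za : A → ℤ, ∀ zb : B → ℤ,
        (∀ a, za a ∈ voteSet (rA a) (jobsOf M a \ jobsOf N a) (jobsOf N a \ jobsOf M a)) →
        (∀ b, zb b ∈ voteSet (rB b) (agentsOf M b \ agentsOf N b) (agentsOf N b \ agentsOf M b)) →
        0 ≤ (∑ a, za a) + ∑ b, zb b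

/-- `M'` is a one-to-one realization of the many-to-many matching `M` in the cloned
instance: every `M'`-edge projects to an `M`-edge, and distinct clones of the same
agent are matched to clones of distinct jobs (so each `M`-edge is used once). -/
def Realizes {A B : Type*} {capA : A → ℕ} {capB : B → ℕ}
    (M' : Clones capA ≃ Clones capB) (M : Finset (A × B)) : Prop :=
  (∀ x, (x.1, (M' x).1) ∈ M) ∧
    ∀ x y : Clones capA, x ≠ y → x.1 = y.1 → (M' x).1 ≠ (M' y).1

/-- The edge set `E'_{M'}` of the instance `G'_{M'}`: the edges of `M'` together
with all clone-copies of edges of `E \ M`. -/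
def inEM {A B : Type*} [DecidableEq A] [DecidableEq B] {capA : A → ℕ} {capB : B → ℕ}
    (E M : Finset (A × B)) (M' : Clones capA ≃ Clones capB)
    (x : Clones capA) (y : Clones capB) : Prop :=
  M' x = y ∨ ((x.1, y.1) ∈ E ∧ (x.1, y.1) ∉ M)

/-- `wt_{M'}(x,y) = vote_x(y, M'(x)) + vote_y(x, M'(y))` in the cloned instance. -/
def wtEdge {A B : Type*} {capA : A → ℕ} {capB : B → ℕ}
    (rA : A → B → ℕ) (rB : B → A → ℕ) (M' : Clones capA ≃ Clones capB)
    (x : Clones capA) (y : Clones capB) : ℤ :=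
  lsgn (rA x.1 y.1) y.2 (rA x.1 (M' x).1) (M' x).2 +
    lsgn (rB y.1 x.1) x.2 (rB y.1 (M'.symm y).1) (M'.symm y).2

/-- An alternating cycle with respect to the (perfect one-to-one) matching `M'`,
with non-matching edges taken from the edge relation `Edge`: the cycle visits the
distinct clones `f 0, g 0, f 1, g 1, …` cyclically, `(f t, g t)` being `M'`-edges
and `(f (t+1), g t)` being non-matching edges of the instance. -/
structure AltCycle {A B : Type*} {capA : A → ℕ} {capB : B → ℕ}
    (M' : Clones capA ≃ Clones capB)
    (Edge : Clones capA → Clones capB → Prop) where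
  m : ℕ
  f : Fin (m + 2) → Clones capA
  g : Fin (m + 2) → Clones capB
  hf : Function.Injective f
  hg : Function.Injective g
  hmatch : ∀ t, M' (f t) = g t
  hnonmatch : ∀ t, M' (f (t + 1)) ≠ g t
  hedge : ∀ t, Edge (f (t + 1)) (g t)

/-- The weight `wt_{M'}(C)` of an alternating cycle: the sum of the weights of all
its edges. -/
def AltCycle.wt {A B : Type*} {capA : A → ℕ} {capB : B → ℕ}
    {M' : Clones capA ≃ Clones capB} {Edge : Clones capA → Clones capB → Prop}
    (C : AltCycle M' Edge) (rA : A → B → ℕ) (rB : B → A → ℕ) : ℤ :=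
  ∑ t : Fin (C.m + 2),
    (wtEdge rA rB M' (C.f t) (C.g t) + wtEdge rA rB M' (C.f (t + 1)) (C.g t))

/-- A cycle is valid if no two of its non-matching edges are clone-copies of the
same edge of `G` (matching edges are automatically distinct copies). -/
def AltCycle.Valid {A B : Type*} {capA : A → ℕ} {capB : B → ℕ}
    {M' : Clones capA ≃ Clones capB} {Edge : Clones capA → Clones capB → Prop}
    (C : AltCycle M' Edge) : Prop :=
  Function.Injective (fun t : Fin (C.m + 2) => ((C.f (t + 1)).1, (C.g t).1))

/-- A matching in the colorful many-to-many multigraph `G*`: a set of colored edges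
`(a, b, c)` with `(a,b) ∈ E` and color `c < n₀`, at most one color per underlying
edge, respecting the capacities. -/
def ColMatching {A B : Type*} [DecidableEq A] [DecidableEq B]
    (E : Finset (A × B)) (capA : A → ℕ) (capB : B → ℕ) (n0 : ℕ)
    (Ms : Finset (A × B × ℕ)) : Prop :=
  (∀ e ∈ Ms, (e.1, e.2.1) ∈ E ∧ e.2.2 < n0) ∧
    (∀ e ∈ Ms, ∀ f ∈ Ms, e.1 = f.1 → e.2.1 = f.2.1 → e = f) ∧
    (∀ a, (Ms.filter (fun e => e.1 = a)).card ≤ capA a) ∧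
    ∀ b, (Ms.filter (fun e => e.2.1 = b)).card ≤ capB b

/-- The colored edge `(x,y)_c` blocks `Ms` in `G*`: `x` is not fully matched or
prefers `(x,y)_c` to its worst `Ms`-edge (agents prefer lower colors, then their
usual ranking), and symmetrically for `y` (jobs prefer higher colors). -/
def ColBlocks {A B : Type*} [DecidableEq A] [DecidableEq B]
    (capA : A → ℕ) (capB : B → ℕ) (rA : A → B → ℕ) (rB : B → A → ℕ)
    (Ms : Finset (A × B × ℕ)) (x : A) (y : B) (c : ℕ) : Prop :=
  ((Ms.filter (fun e => e.1 = x)).card < capA x ∨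
      ∃ f ∈ Ms, f.1 = x ∧ (c < f.2.2 ∨ (c = f.2.2 ∧ rA x y < rA x f.2.1))) ∧
    ((Ms.filter (fun e => e.2.1 = y)).card < capB y ∨
      ∃ f ∈ Ms, f.2.1 = y ∧ (f.2.2 < c ∨ (f.2.2 = c ∧ rB y x < rB y f.1)))

/-- `Ms` is a stable matching in the colorful many-to-many multigraph `G*`: it is a
matching and no colored copy of an edge of `E` outside the projection of `Ms`
blocks it. -/
def ColStable {A B : Type*} [DecidableEq A] [DecidableEq B]
    (E : Finset (A × B)) (capA : A → ℕ) (capB : B → ℕ)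
    (rA : A → B → ℕ) (rB : B → A → ℕ) (n0 : ℕ)
    (Ms : Finset (A × B × ℕ)) : Prop :=
  ColMatching E capA capB n0 Ms ∧
    ∀ x y c, (x, y) ∈ E → (x, y) ∉ Ms.image (fun e => (e.1, e.2.1)) → c < n0 →
      ¬ ColBlocks capA capB rA rB Ms x y c

/-- `M0` is a one-to-one realization of the colored matching `Ms` on the clones:
colored clone edges projecting bijectively onto `Ms`, with each clone on at most
one edge, and the colors preserved. -/
def ColRealizes {A B : Type*} [DecidableEq A] [DecidableEq B]
    {capA : A → ℕ} {capB : B → ℕ}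
    (M0 : Finset (Clones capA × Clones capB × ℕ)) (Ms : Finset (A × B × ℕ)) : Prop :=
  M0.image (fun e => (e.1.1, e.2.1.1, e.2.2)) = Ms ∧
    M0.card = Ms.card ∧
    ∀ e ∈ M0, ∀ f ∈ M0, e ≠ f → e.1 ≠ f.1 ∧ e.2.1 ≠ f.2.1

/-- Edge set of the colorful one-to-one instance `G⁰_{M'}`: all colors `c < n₀` of
the edges of `E'_{M'}`, i.e. of the edges of `M'` (the colorless projection `Mcl` of
`M0` to clone pairs) together with all clone-copies of edges of `E` outside the
projection `Mproj` of `Ms` to `A × B`. -/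
def inE0 {A B : Type*} [DecidableEq A] [DecidableEq B]
    {capA : A → ℕ} {capB : B → ℕ}
    (E : Finset (A × B)) (Mproj : Finset (A × B))
    (Mcl : Finset (Clones capA × Clones capB))
    (x : Clones capA) (y : Clones capB) (c n0 : ℕ) : Prop :=
  c < n0 ∧ ((x, y) ∈ Mcl ∨ ((x.1, y.1) ∈ E ∧ (x.1, y.1) ∉ Mproj))

/-- The colored clone edge `(x,y)_c` blocks the one-to-one matching `M0` in
`G⁰_{M'}`: each endpoint is unmatched or prefers `(x,y)_c` to its `M0`-edge, where
clones of agents prefer lower colors, then rank, then lower clone index, and clones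
of jobs prefer higher colors, then rank, then lower clone index. -/
def Blocks0 {A B : Type*} [DecidableEq A] [DecidableEq B]
    {capA : A → ℕ} {capB : B → ℕ}
    (rA : A → B → ℕ) (rB : B → A → ℕ)
    (M0 : Finset (Clones capA × Clones capB × ℕ))
    (x : Clones capA) (y : Clones capB) (c : ℕ) : Prop :=
  (∀ f ∈ M0, f.1 = x →
      (c < f.2.2 ∨ (c = f.2.2 ∧ (rA x.1 y.1 < rA x.1 f.2.1.1 ∨
        (rA x.1 y.1 = rA x.1 f.2.1.1 ∧ (y.2 : ℕ) < (f.2.1.2 : ℕ)))))) ∧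
    ∀ f ∈ M0, f.2.1 = y →
      (f.2.2 < c ∨ (f.2.2 = c ∧ (rB y.1 x.1 < rB y.1 f.1.1 ∨
        (rB y.1 x.1 = rB y.1 f.1.1 ∧ (x.2 : ℕ) < (f.1.2 : ℕ)))))

/-- `M0` is a stable matching in the colorful one-to-one instance `G⁰_{M'}`:
no edge of `G⁰_{M'}` outside `M0` blocks `M0`. -/
def Stable0 {A B : Type*} [DecidableEq A] [DecidableEq B]
    {capA : A → ℕ} {capB : B → ℕ}
    (E : Finset (A × B)) (Mproj : Finset (A × B))
    (rA : A → B → ℕ) (rB : B → A → ℕ) (n0 : ℕ)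
    (M0 : Finset (Clones capA × Clones capB × ℕ)) : Prop :=
  ∀ (x : Clones capA) (y : Clones capB) (c : ℕ),
    inE0 E Mproj (M0.image (fun e => (e.1, e.2.1))) x y c n0 →
    (x, y, c) ∉ M0 → ¬ Blocks0 rA rB M0 x y c


/-- The total weight of the consecutive pairs of a list. -/
def pathWeight {V : Type*} (u : V → V → ℤ) : List V → ℤ
  | [] => 0
  | [_] => 0
  | a :: b :: l => u a b + pathWeight u (b :: l)

lemma pathWeight_append {V : Type*} (u : V → V → ℤ) (l₁ : List V) (x : V) (l₂ : List V) :
    pathWeight u (l₁ ++ x :: l₂) = pathWeight u (l₁ ++ [x]) + pathWeight u (x :: l₂) := by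
  induction l₁ with
  | nil => simp [pathWeight]
  | cons a l ih =>
    cases l with
    | nil => simp [pathWeight]
    | cons b l => simpa [pathWeight, add_assoc] using ih

lemma pathWeight_lt_length {V : Type*} {R : V → V → Prop} {u : V → V → ℤ}
    (hu : ∀ a b, R a b → u a b ≤ 1) (a : V) (l : List V) (h : List.IsChain R (a :: l)) :
    pathWeight u (a :: l) < (a :: l).length := by
  induction l generalizing a with
  | nil => simp [pathWeight]
  | cons b l ih =>
    rw [List.isChain_cons_cons] at h
    have h₁ := ih b h.2
    have h₂ := hu a b h.1
    simp only [pathWeight, List.length_cons, Nat.cast_add, Nat.cast_one] at h₁ ⊢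
    linarith

lemma pathWeight_snoc_eq_sum_zipWith {V : Type*} (u : V → V → ℤ) (a x : V) (l : List V) :
    pathWeight u (a :: l ++ [x]) = (List.zipWith u (a :: l) (l ++ [x])).sum := by
  induction l generalizing a with
  | nil => simp [pathWeight]
  | cons b l ih => simpa [pathWeight] using ih b

lemma sum_formPerm_eq_pathWeight {V : Type*} [Fintype V] [DecidableEq V] {u : V → V → ℤ}
    (hu : ∀ a, u a a = 0) {a : V} {l : List V} (h : (a :: l).Nodup) :
    ∑ x, u x ((a :: l).formPerm x) = pathWeight u (a :: l ++ [a]) := by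
  have hrot : (a :: l).map (a :: l).formPerm = l ++ [a] := by
    apply List.ext_getElem (by simp)
    intro i h₁ h₂
    rw [List.getElem_map, List.formPerm_apply_getElem _ h,
      ← List.getElem_rotate (a :: l) 1 i (by simpa using h₁)]
    simp
  rw [pathWeight_snoc_eq_sum_zipWith, ← hrot, List.zipWith_map_right, List.zipWith_self,
    ← List.sum_toFinset _ h]
  symm
  apply Finset.sum_subset (Finset.subset_univ _)
  intro x _ hx
  rw [List.formPerm_apply_of_notMem (by simpa using hx), hu]

lemma rel_formPerm_of_isChain {V : Type*} [DecidableEq V] {R : V → V → Prop} {a : V} {l : List V}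
    (h : (a :: l).Nodup) (hch : List.IsChain R (a :: l ++ [a])) {x : V}
    (hx : (a :: l).formPerm x ≠ x) : R x ((a :: l).formPerm x) := by
  obtain ⟨i, hi, rfl⟩ := List.getElem_of_mem (List.mem_of_formPerm_apply_ne hx)
  rw [List.formPerm_apply_getElem _ h]
  have hR := List.isChain_iff_getElem.1 hch i (by simpa using hi)
  rw [List.getElem_append_left hi] at hR
  convert hR using 1
  rcases Nat.lt_or_ge (i + 1) (a :: l).length with hlt | hge
  · rw [List.getElem_append_left hlt]
    simp only [Nat.mod_eq_of_lt hlt]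
  · have hlen : i + 1 = (a :: l).length := by omega
    rw [List.getElem_append_right hge]
    simp [hlen]

/-- A weighted digraph on `M` without positive cycles, all of whose weights are at most `1`, has
a feasible potential with values below `M.card`. -/
lemma exists_potential {V : Type*} [Fintype V] [DecidableEq V] (M : Finset V)
    (R : V → V → Prop) (u : V → V → ℤ) (hRne : ∀ a b, R a b → a ≠ b)
    (hu1 : ∀ a b, R a b → u a b ≤ 1) (hu0 : ∀ a, u a a = 0)
    (hcyc : ∀ π : Equiv.Perm V, (∀ x, π x ≠ x → R x (π x)) → ∑ x, u x (π x) ≤ 0) :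
    ∃ p : V → ℕ, (∀ a ∈ M, p a < M.card) ∧
      ∀ a b, a ∈ M → b ∈ M → R a b → (p b : ℤ) + u a b ≤ p a := by
  have key : ∀ a, ∃ k : ℕ, a ∈ M → k < M.card ∧
      (∃ l : List V, (a :: l).Nodup ∧ (∀ x ∈ a :: l, x ∈ M) ∧ List.IsChain R (a :: l) ∧
        pathWeight u (a :: l) = k) ∧
      ∀ l : List V, (a :: l).Nodup → (∀ x ∈ a :: l, x ∈ M) → List.IsChain R (a :: l) →
        pathWeight u (a :: l) ≤ k := by
    intro a
    by_cases ha : a ∈ M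
    swap
    · exact ⟨0, fun h => absurd h ha⟩
    have bound : ∀ l : List V, (a :: l).Nodup → (∀ x ∈ a :: l, x ∈ M) →
        List.IsChain R (a :: l) → pathWeight u (a :: l) < M.card := by
      intro l hnd hM hch
      refine (pathWeight_lt_length hu1 a l hch).trans_le ?_
      rw [← List.toFinset_card_of_nodup hnd]
      exact_mod_cast Finset.card_le_card fun x hx => hM x (by simpa using hx)
    obtain ⟨k, ⟨l, hnd, hM, hch, hk⟩, hmax⟩ := Int.exists_greatest_of_bdd
      (P := fun k => ∃ l : List V, (a :: l).Nodup ∧ (∀ x ∈ a :: l, x ∈ M) ∧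
        List.IsChain R (a :: l) ∧ pathWeight u (a :: l) = k)
      ⟨M.card, by rintro _ ⟨l, h₁, h₂, h₃, rfl⟩; exact (bound l h₁ h₂ h₃).le⟩
      ⟨0, [], by simp [pathWeight, ha]⟩
    have h0 : 0 ≤ k := hmax 0 ⟨[], by simp [pathWeight, ha]⟩
    lift k to ℕ using h0
    refine ⟨k, fun _ => ⟨?_, ⟨l, hnd, hM, hch, hk⟩,
      fun l h₁ h₂ h₃ => hmax _ ⟨l, h₁, h₂, h₃, rfl⟩⟩⟩
    have := bound l hnd hM hch
    omega
  choose p hp using key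
  refine ⟨p, fun a ha => (hp a ha).1, fun a b ha hb hab => ?_⟩
  obtain ⟨l, hnd, hM, hch, hl⟩ := (hp b hb).2.1
  have hmax := (hp a ha).2.2
  by_cases hmem : a ∈ b :: l
  · have hal : a ∈ l := by simpa [hRne a b hab] using hmem
    obtain ⟨l₁, l₂, rfl⟩ := List.append_of_mem hal
    have hsplit := pathWeight_append u (b :: l₁) a l₂
    have hch' : List.IsChain R ((b :: l₁) ++ a :: l₂) := hch
    rw [List.isChain_split] at hch'
    have htail := hmax l₂ (hnd.sublist (by simp)) (fun x hx => hM x (by simp at hx ⊢; tauto)) hch'.2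
    have hnd' : (b :: (l₁ ++ [a])).Nodup := hnd.sublist (by simp)
    have hloop : List.IsChain R ((b :: l₁) ++ a :: [b]) := by
      rw [List.isChain_split]
      exact ⟨hch'.1, by simpa using hab⟩
    have hc := hcyc (b :: (l₁ ++ [a])).formPerm
      fun x hx => rel_formPerm_of_isChain hnd' (by simpa using hloop) hx
    rw [sum_formPerm_eq_pathWeight hu0 hnd'] at hc
    have hcl := pathWeight_append u (b :: l₁) a [b]
    simp only [List.cons_append, List.append_assoc, List.nil_append, pathWeight] at *
    linarith
  · have := hmax (b :: l) (List.nodup_cons.2 ⟨hmem, hnd⟩)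
      (by simpa [ha] using hM) (List.isChain_cons_cons.2 ⟨hab, hch⟩)
    simp only [pathWeight] at this
    linarith

/-- The edge outside `M` along which an alternating cycle passes from one edge of `M` to the
next. -/
def switchEdge {A B : Type*} (e f : A × B) : A × B := (f.1, e.2)

/-- `f` may follow `e` in an alternating cycle. -/
def CanSwitch {A B : Type*} (E M : Finset (A × B)) (e f : A × B) : Prop :=
  e ∈ M ∧ f ∈ M ∧ switchEdge e f ∈ E ∧ switchEdge e f ∉ M

/-- The votes of the endpoints of `switchEdge e f`, comparing the edges `f` and `e` of `M` with
it. -/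
def switchVote {A B : Type*} (rA : A → B → ℕ) (rB : B → A → ℕ) (e f : A × B) : ℤ :=
  vsgn (rA f.1 f.2) (rA f.1 e.2) + vsgn (rB e.2 e.1) (rB e.2 f.1)

lemma vsgn_self (x : ℕ) : vsgn x x = 0 := by simp [vsgn]

lemma switchVote_self {A B : Type*} (rA : A → B → ℕ) (rB : B → A → ℕ) (e : A × B) :
    switchVote rA rB e e = 0 := by simp [switchVote, vsgn_self]

lemma CanSwitch.ne {A B : Type*} {E M : Finset (A × B)} {e f : A × B} (h : CanSwitch E M e f) :
    e ≠ f := by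
  rintro rfl
  exact h.2.2.2 h.1

lemma CanSwitch.swap {A B : Type*} {E M : Finset (A × B)} {e f e' f' : A × B}
    (h : CanSwitch E M e f) (h' : CanSwitch E M e' f') (heq : switchEdge e f = switchEdge e' f') :
    CanSwitch E M e f' := by
  obtain ⟨h₁, h₂⟩ := Prod.ext_iff.1 heq
  have : switchEdge e f' = switchEdge e f := Prod.ext h₁.symm rfl
  exact ⟨h.1, h'.2.1, this ▸ h.2.2⟩

lemma switchVote_swap {A B : Type*} (rA : A → B → ℕ) (rB : B → A → ℕ) {e f e' f' : A × B}
    (heq : switchEdge e f = switchEdge e' f') :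
    switchVote rA rB e f' + switchVote rA rB e' f =
      switchVote rA rB e f + switchVote rA rB e' f' := by
  obtain ⟨h₁, h₂⟩ := Prod.ext_iff.1 heq
  simp only [switchEdge] at h₁ h₂
  simp only [switchVote, h₁, h₂]
  ring

/-- Induction step for sums over permutations which are not cycles: they split into disjoint
permutations of smaller support. -/
lemma sum_perm_nonneg_of_not_isCycle {V : Type*} [Fintype V] [DecidableEq V] {R : V → V → Prop}
    {u : V → V → ℤ} (hu0 : ∀ a, u a a = 0) {π : Equiv.Perm V} (hcycle : ¬ π.IsCycle)
    (hR : ∀ x, π x ≠ x → R x (π x))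
    (ih : ∀ ρ : Equiv.Perm V, ρ.support.card < π.support.card →
      (∀ x, ρ x ≠ x → R x (ρ x)) → 0 ≤ ∑ x, u x (ρ x)) :
    0 ≤ ∑ x, u x (π x) := by
  classical
  by_cases h1 : π = 1
  · simp [h1, hu0]
  obtain ⟨z, hz⟩ : ∃ z, π z ≠ z := by
    by_contra! h
    exact h1 (Equiv.ext h)
  set c := π.cycleOf z with hc
  have hcin : ∀ x, π.SameCycle z x → c x = π x := fun x hx => hx.cycleOf_apply
  have hcout : ∀ x, ¬ π.SameCycle z x → c x = x :=
    fun x hx => Equiv.Perm.cycleOf_apply_of_not_sameCycle hx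
  have hdin : ∀ x, π.SameCycle z x → (c⁻¹ * π) x = x := fun x hx => by
    rw [Equiv.Perm.mul_apply, ← hcin x hx, Equiv.Perm.inv_eq_iff_eq]
  have hdout : ∀ x, ¬ π.SameCycle z x → (c⁻¹ * π) x = π x := fun x hx => by
    rw [Equiv.Perm.mul_apply, Equiv.Perm.inv_eq_iff_eq,
      hcout (π x) (by rwa [Equiv.Perm.sameCycle_apply_right])]
  have hsum : ∑ x, u x (π x) = ∑ x, u x (c x) + ∑ x, u x ((c⁻¹ * π) x) := by
    rw [← Finset.sum_add_distrib]
    refine Finset.sum_congr rfl fun x _ => ?_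
    by_cases hx : π.SameCycle z x
    · rw [hcin x hx, hdin x hx, hu0, add_zero]
    · rw [hcout x hx, hdout x hx, hu0, zero_add]
  rw [hsum]
  refine add_nonneg (ih c ?_ ?_) (ih _ ?_ ?_)
  · refine Finset.card_lt_card ⟨Equiv.Perm.support_cycleOf_le π z, fun hle => hcycle ?_⟩
    have : c = π := by
      ext x
      by_cases hx : π.SameCycle z x
      · exact hcin x hx
      · by_contra hne
        have hxs : π x ≠ x := by rwa [hcout x hx, eq_comm] at hne
        exact (Equiv.Perm.mem_support.1 (hle (Equiv.Perm.mem_support.2 hxs))) (hcout x hx)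
    exact this ▸ Equiv.Perm.isCycle_cycleOf π hz
  · intro x hx
    by_cases h : π.SameCycle z x
    · rw [hcin x h] at hx ⊢
      exact hR x hx
    · exact absurd (hcout x h) hx
  · refine Finset.card_lt_card ⟨fun x hx => ?_, fun hle => ?_⟩
    · rw [Equiv.Perm.mem_support] at hx ⊢
      by_cases h : π.SameCycle z x
      · exact absurd (hdin x h) hx
      · rwa [hdout x h] at hx
    · exact (Equiv.Perm.mem_support.1 (hle (Equiv.Perm.mem_support.2 hz)))
        (hdin z (Equiv.Perm.SameCycle.refl _ _))
  · intro x hx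
    by_cases h : π.SameCycle z x
    · exact absurd (hdin x h) hx
    · rw [hdout x h] at hx ⊢
      exact hR x hx

/-- It suffices to bound the vote sums of cycles which use no edge outside `M` twice. -/
lemma sum_switchVote_nonneg {A B : Type*} [Fintype A] [Fintype B] [DecidableEq A] [DecidableEq B]
    {E M : Finset (A × B)} {rA : A → B → ℕ} {rB : B → A → ℕ}
    (hvalid : ∀ π : Equiv.Perm (A × B), (∀ e, π e ≠ e → CanSwitch E M e (π e)) →
      Set.InjOn (fun e => switchEdge e (π e)) π.support → 0 ≤ ∑ e, switchVote rA rB e (π e))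
    (π : Equiv.Perm (A × B)) (hπ : ∀ e, π e ≠ e → CanSwitch E M e (π e)) :
    0 ≤ ∑ e, switchVote rA rB e (π e) := by
  induction hn : π.support.card using Nat.strong_induction_on generalizing π with
  | _ n ih =>
  subst hn
  have ih' : ∀ ρ : Equiv.Perm (A × B), ρ.support.card < π.support.card →
      (∀ e, ρ e ≠ e → CanSwitch E M e (ρ e)) → 0 ≤ ∑ e, switchVote rA rB e (ρ e) :=
    fun ρ hρ h => ih _ hρ ρ h rfl
  by_cases hcycle : π.IsCycle
  swap
  · exact sum_perm_nonneg_of_not_isCycle (switchVote_self rA rB) hcycle hπ ih'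
  by_cases hinj : Set.InjOn (fun e => switchEdge e (π e)) π.support
  · exact hvalid π hπ hinj
  simp only [Set.InjOn, not_forall] at hinj
  obtain ⟨e, he, f, hf, heq, hne⟩ := hinj
  have hse := hπ e (by simpa using he)
  have hsf := hπ f (by simpa using hf)
  set ρ := π * Equiv.swap e f with hρ
  have hρe : ρ e = π f := by simp [hρ]
  have hρf : ρ f = π e := by simp [hρ]
  have hρx : ∀ x, x ≠ e → x ≠ f → ρ x = π x := fun x h₁ h₂ => by
    simp [hρ, Equiv.swap_apply_of_ne_of_ne h₁ h₂]
  have hR : ∀ x, ρ x ≠ x → CanSwitch E M x (ρ x) := by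
    intro x hx
    by_cases h₁ : x = e
    · subst h₁; rw [hρe]; exact hse.swap hsf heq
    by_cases h₂ : x = f
    · subst h₂; rw [hρf]; exact hsf.swap hse heq.symm
    rw [hρx x h₁ h₂] at hx ⊢
    exact hπ x hx
  have hsupp : ρ.support = π.support := by
    ext x
    by_cases h₁ : x = e
    · subst h₁
      simp only [Equiv.Perm.mem_support, hρe]
      exact iff_of_true (hse.swap hsf heq).ne.symm hse.ne.symm
    by_cases h₂ : x = f
    · subst h₂
      simp only [Equiv.Perm.mem_support, hρf]
      exact iff_of_true (hsf.swap hse heq.symm).ne.symm hsf.ne.symm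
    simp only [Equiv.Perm.mem_support, hρx x h₁ h₂]
  have hnot : ¬ ρ.IsCycle := by
    intro hc
    have h₁ := hc.sign
    rw [hsupp, ← hcycle.sign, hρ, Equiv.Perm.sign_mul, Equiv.Perm.sign_swap hne] at h₁
    rcases Int.units_eq_one_or (Equiv.Perm.sign π) with h | h <;> rw [h] at h₁ <;>
      exact absurd h₁ (by decide)
  have hsum : ∑ x, switchVote rA rB x (π x) = ∑ x, switchVote rA rB x (ρ x) := by
    have hsplit : ∀ σ : Equiv.Perm (A × B), ∑ x, switchVote rA rB x (σ x) =
        switchVote rA rB e (σ e) + switchVote rA rB f (σ f) +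
          ∑ x ∈ (Finset.univ.erase e).erase f, switchVote rA rB x (σ x) := fun σ => by
      rw [← Finset.add_sum_erase _ _ (Finset.mem_univ e),
        ← Finset.add_sum_erase (Finset.univ.erase e) _
          (Finset.mem_erase.2 ⟨Ne.symm hne, Finset.mem_univ f⟩), add_assoc]
    rw [hsplit π, hsplit ρ, hρe, hρf, switchVote_swap rA rB heq]
    congr 1
    refine Finset.sum_congr rfl fun x hx => ?_
    simp only [Finset.mem_erase] at hx
    rw [hρx x hx.2.1 hx.1]
  rw [hsum]
  exact sum_perm_nonneg_of_not_isCycle (switchVote_self rA rB) hnot hR (hsupp ▸ ih')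

lemma mem_jobsOf {A B : Type*} [DecidableEq A] [DecidableEq B] {M : Finset (A × B)} {a : A}
    {b : B} : b ∈ jobsOf M a ↔ (a, b) ∈ M := by
  simp [jobsOf]

lemma mem_agentsOf {A B : Type*} [DecidableEq A] [DecidableEq B] {M : Finset (A × B)} {a : A}
    {b : B} : a ∈ agentsOf M b ↔ (a, b) ∈ M := by
  simp [agentsOf]

lemma sum_vsgn_mem_voteSet {B : Type*} (r : B → ℕ) (S T : Finset B) (k : B → B)
    (hmaps : ∀ x ∈ S, k x ∈ T) (hinj : ∀ x ∈ S, ∀ y ∈ S, k x = k y → x = y)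
    (hsurj : ∀ y ∈ T, ∃ x ∈ S, k x = y) :
    ∑ x ∈ S, vsgn (r x) (r (k x)) ∈ voteSet r S T := by
  refine ⟨Equiv.ofBijective (fun x => ⟨k x.1, hmaps x.1 x.2⟩) ⟨fun x y h => ?_, fun y => ?_⟩, ?_⟩
  · exact Subtype.ext (hinj _ x.2 _ y.2 (congrArg Subtype.val h))
  · obtain ⟨x, hx, h⟩ := hsurj y.1 y.2
    exact ⟨⟨x, hx⟩, Subtype.ext h⟩
  · exact (Finset.sum_coe_sort S fun x => vsgn (r x) (r (k x))).symm

/-- A value in the vote set comes from a map `p` pairing each element of `T` with one of `S`. -/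
lemma exists_pairing_of_mem_voteSet {B : Type*} {r : B → ℕ} {S T : Finset B} {z : ℤ}
    (hz : z ∈ voteSet r S T) :
    ∃ p : B → B, (∀ y ∈ T, p y ∈ S) ∧ z = ∑ y ∈ T, vsgn (r (p y)) (r y) ∧
      ∀ g : B → ℤ, ∑ y ∈ T, g (p y) = ∑ x ∈ S, g x := by
  classical
  obtain ⟨σ, rfl⟩ := hz
  have hp : ∀ y : {x // x ∈ T},
      (if h : y.1 ∈ T then (σ.symm ⟨y.1, h⟩ : B) else y.1) = σ.symm y := fun y => by simp
  refine ⟨fun y => if h : y ∈ T then σ.symm ⟨y, h⟩ else y, fun y hy => by simp [hy], ?_, ?_⟩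
  · rw [← Finset.sum_coe_sort T]
    simp only [hp]
    rw [← Equiv.sum_comp σ]
    simp
  · intro g
    rw [← Finset.sum_coe_sort T, ← Finset.sum_coe_sort S]
    simp only [hp]
    exact Equiv.sum_comp σ.symm (fun x => g x.1)

lemma CanSwitch.rank_ne {A B : Type*} {E M : Finset (A × B)} {rA : A → B → ℕ} {rB : B → A → ℕ}
    (hrA : ∀ a, Function.Injective (rA a)) (hrB : ∀ b, Function.Injective (rB b)) {e f : A × B}
    (h : CanSwitch E M e f) :
    rA f.1 f.2 ≠ rA f.1 e.2 ∧ rB e.2 e.1 ≠ rB e.2 f.1 := by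
  constructor
  · intro heq
    exact h.2.2.2 (by rw [switchEdge, ← hrA _ heq]; exact h.2.1)
  · intro heq
    exact h.2.2.2 (by rw [switchEdge, ← hrB _ heq]; exact h.1)

/-- Stability in the colored instance says that the coloring is a potential for the halved votes
along alternating cycles. -/
lemma colStable_iff {A B : Type*} [DecidableEq A] [DecidableEq B]
    {capA : A → ℕ} {capB : B → ℕ} {rA : A → B → ℕ} {rB : B → A → ℕ}
    (hrA : ∀ a, Function.Injective (rA a)) (hrB : ∀ b, Function.Injective (rB b))
    {E M : Finset (A × B)} (hM : IsPerfect E M capA capB) {n0 : ℕ} {col : A × B → ℕ}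
    (hcol : ∀ e ∈ M, col e < n0) :
    ColStable E capA capB rA rB n0 (M.image (fun e => (e.1, e.2, col e))) ↔
      ∀ e f, CanSwitch E M e f → 2 * (col f : ℤ) ≤ 2 * col e + switchVote rA rB e f := by
  have hinj : Function.Injective (fun e : A × B => (e.1, e.2, col e)) := fun e f h => by
    simp only [Prod.mk.injEq] at h
    exact Prod.ext h.1 h.2.1
  have hcardA : ∀ a, ((M.image (fun e => (e.1, e.2, col e))).filter (fun e => e.1 = a)).card =
      capA a := fun a => by
    rw [Finset.filter_image, Finset.card_image_of_injective _ hinj, ← hM.2.1 a]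
  have hcardB : ∀ b, ((M.image (fun e => (e.1, e.2, col e))).filter (fun e => e.2.1 = b)).card =
      capB b := fun b => by
    rw [Finset.filter_image, Finset.card_image_of_injective _ hinj, ← hM.2.2 b]
  have hproj : (M.image (fun e => (e.1, e.2, col e))).image (fun e => (e.1, e.2.1)) = M := by
    simp [Finset.image_image, Function.comp_def]
  have hmatching : ColMatching E capA capB n0 (M.image (fun e => (e.1, e.2, col e))) := by
    refine ⟨?_, ?_, fun a => (hcardA a).le, fun b => (hcardB b).le⟩
    · intro e he
      obtain ⟨f, hf, rfl⟩ := Finset.mem_image.1 he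
      exact ⟨hM.1 hf, hcol f hf⟩
    · intro e he f hf h₁ h₂
      obtain ⟨e, -, rfl⟩ := Finset.mem_image.1 he
      obtain ⟨f, -, rfl⟩ := Finset.mem_image.1 hf
      rw [show e = f from Prod.ext h₁ h₂]
  have hblocks : ∀ x y c, ColBlocks capA capB rA rB (M.image (fun e => (e.1, e.2, col e))) x y c ↔
      (∃ f ∈ M, f.1 = x ∧ (c < col f ∨ c = col f ∧ rA x y < rA x f.2)) ∧
        ∃ e ∈ M, e.2 = y ∧ (col e < c ∨ col e = c ∧ rB y x < rB y e.1) := fun x y c => by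
    unfold ColBlocks
    rw [hcardA, hcardB]
    simp only [lt_irrefl, false_or, Finset.exists_mem_image]
  rw [ColStable, hproj, and_iff_right hmatching]
  simp only [hblocks]
  constructor
  · intro h e f hef
    obtain ⟨hA, hB⟩ := CanSwitch.rank_ne hrA hrB hef
    have hblock : ∀ c, c < n0 → ¬ ((c < col f ∨ c = col f ∧ rA f.1 e.2 < rA f.1 f.2) ∧
        (col e < c ∨ col e = c ∧ rB e.2 f.1 < rB e.2 e.1)) := fun c hc hb =>
      h f.1 e.2 c hef.2.2.1 hef.2.2.2 hc ⟨⟨f, hef.2.1, rfl, hb.1⟩, e, hef.1, rfl, hb.2⟩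
    have h₁ := hblock _ (hcol f hef.2.1)
    have h₂ := hblock _ (hcol e hef.1)
    have hf := hcol f hef.2.1
    have h₃ := hblock (col e + 1)
    unfold switchVote vsgn
    split_ifs <;> omega
  · rintro h x y c hE hM' hc ⟨⟨f, hf, rfl, hcf⟩, e, he, rfl, hce⟩
    have := h e f ⟨he, hf, hE, hM'⟩
    unfold switchVote vsgn at this
    split_ifs at this <;> omega

/-- A potential for the halved votes shows popularity. -/
lemma popularPerfect_of_potential {A B : Type*} [Fintype A] [Fintype B] [DecidableEq A]
    [DecidableEq B] {capA : A → ℕ} {capB : B → ℕ} {rA : A → B → ℕ} {rB : B → A → ℕ}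
    {E M : Finset (A × B)} (hM : IsPerfect E M capA capB) (col : A × B → ℕ)
    (hcol : ∀ e f, CanSwitch E M e f → 2 * (col f : ℤ) ≤ 2 * col e + switchVote rA rB e f) :
    PopularPerfect E capA capB rA rB M := by
  refine ⟨hM, fun N hN za zb hza hzb => ?_⟩
  choose p hpS hpz hpg using fun a => exists_pairing_of_mem_voteSet (hza a)
  choose q hqS hqz hqg using fun b => exists_pairing_of_mem_voteSet (hzb b)
  have hA : ∀ (K L : Finset (A × B)) (F : A × B → ℤ),
      ∑ a, ∑ b ∈ jobsOf K a \ jobsOf L a, F (a, b) = ∑ e ∈ K \ L, F e := fun K L F =>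
    (Finset.sum_finset_product _ _ _ fun e => by simp [mem_jobsOf]).symm
  have hB : ∀ (K L : Finset (A × B)) (F : A × B → ℤ),
      ∑ b, ∑ a ∈ agentsOf K b \ agentsOf L b, F (a, b) = ∑ e ∈ K \ L, F e := fun K L F =>
    (Finset.sum_finset_product_right _ _ _ fun e => by simp [mem_agentsOf]).symm
  have hcolA : ∑ e ∈ N \ M, (col (e.1, p e.1 e.2) : ℤ) = ∑ e ∈ M \ N, (col e : ℤ) := by
    rw [← hA N M fun e => (col (e.1, p e.1 e.2) : ℤ), ← hA M N fun e => (col e : ℤ)]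
    exact Finset.sum_congr rfl fun a _ => hpg a fun b => (col (a, b) : ℤ)
  have hcolB : ∑ e ∈ N \ M, (col (q e.2 e.1, e.2) : ℤ) = ∑ e ∈ M \ N, (col e : ℤ) := by
    rw [← hB N M fun e => (col (q e.2 e.1, e.2) : ℤ), ← hB M N fun e => (col e : ℤ)]
    exact Finset.sum_congr rfl fun b _ => hqg b fun a => (col (a, b) : ℤ)
  have hza' : ∑ a, za a = ∑ e ∈ N \ M, vsgn (rA e.1 (p e.1 e.2)) (rA e.1 e.2) := by
    rw [← hA N M fun e => vsgn (rA e.1 (p e.1 e.2)) (rA e.1 e.2)]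
    exact Finset.sum_congr rfl fun a _ => hpz a
  have hzb' : ∑ b, zb b = ∑ e ∈ N \ M, vsgn (rB e.2 (q e.2 e.1)) (rB e.2 e.1) := by
    rw [← hB N M fun e => vsgn (rB e.2 (q e.2 e.1)) (rB e.2 e.1)]
    exact Finset.sum_congr rfl fun b _ => hqz b
  have key : ∀ e ∈ N \ M, 2 * (col (e.1, p e.1 e.2) : ℤ) - 2 * col (q e.2 e.1, e.2) ≤
      vsgn (rA e.1 (p e.1 e.2)) (rA e.1 e.2) + vsgn (rB e.2 (q e.2 e.1)) (rB e.2 e.1) := by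
    rintro ⟨a, b⟩ he
    rw [Finset.mem_sdiff] at he
    have h₁ := hpS a b (by simpa [mem_jobsOf] using he)
    have h₂ := hqS b a (by simpa [mem_agentsOf] using he)
    simp only [Finset.mem_sdiff, mem_jobsOf, mem_agentsOf] at h₁ h₂
    have := hcol (q b a, b) (a, p a b) ⟨h₂.1, h₁.1, hN.1 he.1, he.2⟩
    simp only [switchVote] at this
    linarith
  have hle := Finset.sum_le_sum key
  rw [Finset.sum_sub_distrib, ← Finset.mul_sum, ← Finset.mul_sum, hcolA, hcolB, sub_self,
    Finset.sum_add_distrib, ← hza', ← hzb'] at hle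
  exact hle

/-- Popularity bounds the vote sum of a cycle which uses no edge outside `M` twice. -/
lemma PopularPerfect.sum_switchVote_nonneg {A B : Type*} [Fintype A] [Fintype B] [DecidableEq A]
    [DecidableEq B] {capA : A → ℕ} {capB : B → ℕ} {rA : A → B → ℕ} {rB : B → A → ℕ}
    {E M : Finset (A × B)} (hpop : PopularPerfect E capA capB rA rB M)
    (π : Equiv.Perm (A × B)) (hπ : ∀ e, π e ≠ e → CanSwitch E M e (π e))
    (hinj : Set.InjOn (fun e => switchEdge e (π e)) π.support) :
    0 ≤ ∑ e, switchVote rA rB e (π e) := by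
  obtain ⟨⟨hME, hMA, hMB⟩, hpop⟩ := hpop
  have hsw : ∀ e ∈ π.support, CanSwitch E M e (π e) :=
    fun e he => hπ e (Equiv.Perm.mem_support.1 he)
  set G := π.support.image (fun e => switchEdge e (π e)) with hG
  have hsuppM : π.support ⊆ M := fun e he => (hsw e he).1
  have hGM : ∀ e ∈ G, e ∉ M := by
    intro e he
    obtain ⟨f, hf, rfl⟩ := Finset.mem_image.1 he
    exact (hsw f hf).2.2.2
  have hGE : G ⊆ E := by
    intro e he
    obtain ⟨f, hf, rfl⟩ := Finset.mem_image.1 he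
    exact (hsw f hf).2.2.1
  have hmemN : ∀ e, e ∈ (M \ π.support) ∪ G ↔ e ∈ M ∧ e ∉ π.support ∨ e ∈ G := fun e => by
    rw [Finset.mem_union, Finset.mem_sdiff]
  have hMN : ∀ e, e ∈ M ∧ e ∉ (M \ π.support) ∪ G ↔ e ∈ π.support := fun e => by
    have h₁ := @hsuppM e
    have h₂ := hGM e
    rw [hmemN]
    tauto
  have hNM : ∀ e, e ∈ (M \ π.support) ∪ G ∧ e ∉ M ↔ e ∈ G := fun e => by
    have h₂ := hGM e
    rw [hmemN]
    tauto
  have hcard : ∀ (P : A × B → Prop) [DecidablePred P],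
      (π.support.filter fun e => P (switchEdge e (π e))).card = (π.support.filter P).card →
      (((M \ π.support) ∪ G).filter P).card = (M.filter P).card := by
    intro P _ h
    rw [Finset.filter_union, Finset.card_union_of_disjoint, hG, Finset.filter_image,
      Finset.card_image_of_injOn (hinj.mono (Finset.coe_subset.2 (Finset.filter_subset _ _))), h,
      ← Finset.card_union_of_disjoint, ← Finset.filter_union, Finset.sdiff_union_of_subset hsuppM]
    · exact Finset.disjoint_filter_filter Finset.sdiff_disjoint
    · refine Finset.disjoint_filter_filter (Finset.disjoint_left.2 fun e he he' => ?_)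
      exact hGM e he' (Finset.mem_sdiff.1 he).1
  have hN : IsPerfect E ((M \ π.support) ∪ G) capA capB := by
    refine ⟨Finset.union_subset (Finset.sdiff_subset.trans hME) hGE, fun a => ?_, fun b => ?_⟩
    · rw [← hMA a]
      apply hcard
      refine Finset.card_bij (fun e _ => π e) ?_ (fun e _ f _ h => π.injective h) ?_
      · intro e he
        rw [Finset.mem_filter] at he ⊢
        exact ⟨Equiv.Perm.apply_mem_support.2 he.1, he.2⟩
      · intro e he
        rw [Finset.mem_filter] at he
        refine ⟨π.symm e, ?_, by simp⟩
        rw [Finset.mem_filter, ← Equiv.Perm.apply_mem_support]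
        simpa [switchEdge] using he
    · rw [← hMB b]
      exact hcard _ rfl
  have hza : ∀ a, ∑ b ∈ jobsOf M a \ jobsOf ((M \ π.support) ∪ G) a,
      vsgn (rA a b) (rA a (π.symm (a, b)).2) ∈ voteSet (rA a)
        (jobsOf M a \ jobsOf ((M \ π.support) ∪ G) a)
        (jobsOf ((M \ π.support) ∪ G) a \ jobsOf M a) := by
    intro a
    apply sum_vsgn_mem_voteSet (rA a) _ _ fun b => (π.symm (a, b)).2
    all_goals simp only [Finset.mem_sdiff, mem_jobsOf, hMN, hNM]
    · intro b hb
      refine Finset.mem_image.2 ⟨π.symm (a, b), ?_, by simp [switchEdge]⟩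
      rwa [← Equiv.Perm.apply_mem_support, Equiv.apply_symm_apply]
    · intro b hb c hc h
      have hmem : ∀ d, (a, d) ∈ π.support → π.symm (a, d) ∈ π.support := fun d hd => by
        rwa [← Equiv.Perm.apply_mem_support, Equiv.apply_symm_apply]
      have := hinj (hmem b hb) (hmem c hc) (by simpa [switchEdge] using h)
      simpa using this
    · intro b hb
      obtain ⟨f, hf, heq⟩ := Finset.mem_image.1 hb
      obtain ⟨h₁, h₂⟩ := Prod.ext_iff.1 heq
      simp only [switchEdge] at h₁ h₂
      have hpf : (a, (π f).2) = π f := Prod.ext h₁.symm rfl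
      refine ⟨(π f).2, ?_, ?_⟩
      · rwa [hpf, Equiv.Perm.apply_mem_support]
      · rwa [hpf, Equiv.symm_apply_apply]
  have hzb : ∀ b, ∑ a ∈ agentsOf M b \ agentsOf ((M \ π.support) ∪ G) b,
      vsgn (rB b a) (rB b (π (a, b)).1) ∈ voteSet (rB b)
        (agentsOf M b \ agentsOf ((M \ π.support) ∪ G) b)
        (agentsOf ((M \ π.support) ∪ G) b \ agentsOf M b) := by
    intro b
    apply sum_vsgn_mem_voteSet (rB b) _ _ fun a => (π (a, b)).1
    all_goals simp only [Finset.mem_sdiff, mem_agentsOf, hMN, hNM]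
    · exact fun a ha => Finset.mem_image.2 ⟨(a, b), ha, rfl⟩
    · intro a ha c hc h
      exact congrArg Prod.fst (hinj ha hc (by simpa [switchEdge] using h))
    · intro a ha
      obtain ⟨⟨f₁, f₂⟩, hf, heq⟩ := Finset.mem_image.1 ha
      obtain ⟨h₁, h₂⟩ := Prod.ext_iff.1 heq
      simp only [switchEdge] at h₁ h₂
      subst h₂
      exact ⟨f₁, hf, h₁⟩
  have hnonneg := hpop _ hN _ _ hza hzb
  have hsumA : ∑ a, ∑ b ∈ jobsOf M a \ jobsOf ((M \ π.support) ∪ G) a,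
      vsgn (rA a b) (rA a (π.symm (a, b)).2) =
        ∑ e, vsgn (rA (π e).1 (π e).2) (rA (π e).1 e.2) := by
    rw [← Finset.sum_finset_product π.support Finset.univ
      (fun a => jobsOf M a \ jobsOf ((M \ π.support) ∪ G) a)
      (fun e => by simp only [Finset.mem_sdiff, mem_jobsOf, hMN, Finset.mem_univ, true_and])
      (f := fun e => vsgn (rA e.1 e.2) (rA e.1 (π.symm e).2)),
      Finset.sum_subset (Finset.subset_univ π.support), ← Equiv.sum_comp π]
    · simp
    · intro e _ he
      have : π e = e := by simpa using he
      rw [(Equiv.symm_apply_eq π).2 this.symm, vsgn_self]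
  have hsumB : ∑ b, ∑ a ∈ agentsOf M b \ agentsOf ((M \ π.support) ∪ G) b,
      vsgn (rB b a) (rB b (π (a, b)).1) = ∑ e, vsgn (rB e.2 e.1) (rB e.2 (π e).1) := by
    rw [← Finset.sum_finset_product_right π.support Finset.univ
      (fun b => agentsOf M b \ agentsOf ((M \ π.support) ∪ G) b)
      (fun e => by simp only [Finset.mem_sdiff, mem_agentsOf, hMN, Finset.mem_univ, true_and])
      (f := fun e => vsgn (rB e.2 e.1) (rB e.2 (π e).1)),
      Finset.sum_subset (Finset.subset_univ π.support)]
    intro e _ he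
    have : π e = e := by simpa using he
    rw [this, vsgn_self]
  rw [hsumA, hsumB, ← Finset.sum_add_distrib] at hnonneg
  exact hnonneg

/-- the main characterization: a perfect matching `M` in a
many-to-many instance `G` is a popular perfect matching if and only if some colorful
version `M*` of `M` (obtained by assigning each edge of `M` a color in
`{1, …, n₀}`, `n₀ = Σ_{a∈A} cap(a)`) is a stable matching in the colorful
multigraph instance `G*`. -/
theorem stmt12 {A B : Type*} [Fintype A] [Fintype B] [DecidableEq A] [DecidableEq B]
    (capA : A → ℕ) (capB : B → ℕ)
    (rA : A → B → ℕ) (rB : B → A → ℕ)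
    (hrA : ∀ a, Function.Injective (rA a)) (hrB : ∀ b, Function.Injective (rB b))
    (E M : Finset (A × B)) (hM : IsPerfect E M capA capB)
    (n0 : ℕ) (hn0 : n0 = ∑ a, capA a) :
    PopularPerfect E capA capB rA rB M ↔
      ∃ col : A × B → ℕ, (∀ e ∈ M, col e < n0) ∧
        ColStable E capA capB rA rB n0 (M.image (fun e => (e.1, e.2, col e))) := by
  have hcard : M.card = n0 := by
    rw [hn0, Finset.card_eq_sum_card_fiberwise (f := Prod.fst) (t := Finset.univ)
      (fun _ _ => Finset.mem_coe.2 (Finset.mem_univ _))]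
    exact Finset.sum_congr rfl fun a _ => hM.2.1 a
  constructor
  · intro hpop
    have hhalf : ∀ e f, CanSwitch E M e f →
        2 * (-switchVote rA rB e f / 2) = -switchVote rA rB e f ∧
          -switchVote rA rB e f / 2 ≤ 1 := by
      intro e f hef
      obtain ⟨hA, hB⟩ := CanSwitch.rank_ne hrA hrB hef
      unfold switchVote vsgn
      split_ifs <;> omega
    obtain ⟨p, hp, hpot⟩ := exists_potential M (CanSwitch E M)
      (fun e f => -switchVote rA rB e f / 2) (fun _ _ h => h.ne) (fun e f h => (hhalf e f h).2)
      (fun e => by simp [switchVote_self]) (by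
        intro π hπ
        have hnonneg := sum_switchVote_nonneg hpop.sum_switchVote_nonneg π hπ
        have hsum : ∑ e, 2 * (-switchVote rA rB e (π e) / 2) =
            ∑ e, -switchVote rA rB e (π e) := by
          refine Finset.sum_congr rfl fun e _ => ?_
          by_cases he : π e = e
          · simp [he, switchVote_self]
          · exact (hhalf e (π e) (hπ e he)).1
        rw [← Finset.mul_sum, Finset.sum_neg_distrib] at hsum
        linarith)
    rw [hcard] at hp
    refine ⟨p, hp, (colStable_iff hrA hrB hM hp).2 fun e f hef => ?_⟩
    have h₁ := hpot e f hef.1 hef.2.1 hef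
    have h₂ := (hhalf e f hef).1
    linarith
  · rintro ⟨col, hcol, hstable⟩
    exact popularPerfect_of_potential hM col ((colStable_iff hrA hrB hM hcol).1 hstable)
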